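/- arXiv:math/0103096 — 2 statements merged into one kernel-verified Lean document; each statement's English description precedes it below -/
import Mathlib

section
/- Let n ≥ 1 be a natural number, let λ, δ be real numbers, set β = (n+1)(1−δ), and for natural numbers m ≤ k define C_m^k = (1/m!) · (k−m+(n+1)λ)_m / (2(k−m)+β+m−1)_m and C̃_m^k = ((−1)^m/m!) · (k−m+(n+1)λ)_m / (2(k−m)+β)_m. Let k ≥ 1 and 1 ≤ p ≤ k, and assume β + t ≠ 0 for every integer t with 2(k−p) ≤ t ≤ 2k−2. Then Σ_{m=0}^{p} C_m^k · C̃_{p−m}^{k−m} = 0. -/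
/-- The Pochhammer symbol `(a)_m = a (a+1) ⋯ (a+m-1)` for a real number `a`. -/
noncomputable def poch (a : ℝ) (m : ℕ) : ℝ := ∏ j ∈ Finset.range m, (a + j)

/-- The coefficients `C_m^k` of the projectively equivariant quantization map
(Corollary 3.2), with `β = (n+1)(1-δ)`. -/
noncomputable def quantCoeff (n : ℕ) (lam δ : ℝ) (m k : ℕ) : ℝ :=
  (1 / (Nat.factorial m : ℝ)) *
    poch (((k : ℝ) - (m : ℝ)) + ((n : ℝ) + 1) * lam) m /
    poch (2 * ((k : ℝ) - (m : ℝ)) + ((n : ℝ) + 1) * (1 - δ) + (m : ℝ) - 1) m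

/-- The coefficients `C̃_m^k` of the projectively equivariant symbol map
(Theorem 3.5), with `β = (n+1)(1-δ)`. -/
noncomputable def symbCoeff (n : ℕ) (lam δ : ℝ) (m k : ℕ) : ℝ :=
  ((-1 : ℝ) ^ m / (Nat.factorial m : ℝ)) *
    poch (((k : ℝ) - (m : ℝ)) + ((n : ℝ) + 1) * lam) m /
    poch (2 * ((k : ℝ) - (m : ℝ)) + ((n : ℝ) + 1) * (1 - δ)) m

theorem poch_add (a : ℝ) (m l : ℕ) : poch a (m + l) = poch a m * poch (a + m) l := by
  unfold poch
  rw [Finset.prod_range_add]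
  congr 1
  apply Finset.prod_congr rfl
  intro j _
  push_cast
  ring

theorem diff_sum_zero (c : ℝ) (p : ℕ) (hp : 1 ≤ p) :
    ∑ m ∈ Finset.range (p + 1),
      ((-1 : ℝ) ^ (p - m) * (p.choose m : ℝ)) * poch (c - m) (p - 1) = 0 := by
  let P : Polynomial ℝ :=
    ∏ j ∈ Finset.range (p - 1), (Polynomial.C (c + j) - Polynomial.X)
  have hdeg : P.natDegree < p := by
    have h1 : P.natDegree ≤ ∑ j ∈ Finset.range (p - 1), 1 := by
      refine (Polynomial.natDegree_prod_le _ _).trans (Finset.sum_le_sum ?_)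
      intro j _
      refine (Polynomial.natDegree_sub_le _ _).trans ?_
      simp
    simp at h1
    omega
  have h := congrFun (Polynomial.fwdDiff_iter_eq_zero_of_degree_lt hdeg) 0
  rw [fwdDiff_iter_eq_sum_shift] at h
  simp only [Pi.zero_apply] at h
  rw [← h]
  apply Finset.sum_congr rfl
  intro m _
  have : Polynomial.eval (0 + m • (1 : ℝ)) P = poch (c - m) (p - 1) := by
    simp only [P, poch, Polynomial.eval_prod]
    apply Finset.prod_congr rfl
    intro j _
    simp
    ring
  rw [this, zsmul_eq_mul]
  push_cast
  ring

/-- Coefficientwise statement that `σ_{λ,μ} ∘ Q_{λ,μ} = id`: the convolution of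
the symbol coefficients with the quantization coefficients vanishes in each
positive degree `p ≥ 1`. -/
theorem symbol_comp_quantization_coeff_vanishes
    (n : ℕ) (hn : 1 ≤ n) (lam δ : ℝ) (k p : ℕ)
    (hk : 1 ≤ k) (hp : 1 ≤ p) (hpk : p ≤ k)
    (hβ : ∀ t : ℕ, 2 * (k - p) ≤ t → t ≤ 2 * k - 2 →
      ((n : ℝ) + 1) * (1 - δ) + (t : ℝ) ≠ 0) :
    ∑ m ∈ Finset.range (p + 1),
      quantCoeff n lam δ m k * symbCoeff n lam δ (p - m) (k - m) = 0 := by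
  set β : ℝ := ((n : ℝ) + 1) * (1 - δ) with hβd
  set b : ℝ := 2 * ((k : ℝ) - p) + β with hb
  set a : ℝ := ((k : ℝ) - p) + ((n : ℝ) + 1) * lam with ha
  have hD : poch b (2 * p - 1) ≠ 0 := by
    unfold poch
    rw [Finset.prod_ne_zero_iff]
    intro j hj
    rw [Finset.mem_range] at hj
    have := hβ (2 * (k - p) + j) (by omega) (by omega)
    push_cast [Nat.cast_sub hpk] at this
    intro h0
    apply this
    rw [← h0, hb]
    ring
  have key : ∀ m ∈ Finset.range (p + 1),
      quantCoeff n lam δ m k * symbCoeff n lam δ (p - m) (k - m) =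
      (poch a p / (p.factorial * poch b (2 * p - 1))) *
        (((-1 : ℝ) ^ (p - m) * (p.choose m : ℝ)) * poch (b + p - m) (p - 1)) := by
    intro m hm
    have hmp : m ≤ p := by
      rw [Finset.mem_range] at hm
      omega
    have e1 : poch a p = poch a (p - m) * poch ((k : ℝ) - m + ((n : ℝ) + 1) * lam) m := by
      conv_lhs => rw [show p = (p - m) + m by omega, poch_add]
      rw [Nat.cast_sub hmp, ha]
      congr 2
      ring
    have e2 : poch b (2 * p - 1) = poch b (p - m) * poch (b + p - m) (p - 1) *
        poch (2 * ((k : ℝ) - m) + β + m - 1) m := by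
      rw [show 2 * p - 1 = (p - m) + (p - 1) + m by omega, poch_add, poch_add]
      push_cast [Nat.cast_sub hmp, Nat.cast_sub hp]
      rw [hb]
      congr 2
      · congr 1
        ring
      · ring
    have e3 : (p.factorial : ℝ) = p.choose m * m.factorial * (p - m).factorial := by
      exact_mod_cast (Nat.choose_mul_factorial_mul_factorial hmp).symm
    have hc : ((k - m : ℕ) : ℝ) - ((p - m : ℕ) : ℝ) = (k : ℝ) - p := by
      rw [Nat.cast_sub hmp, Nat.cast_sub (hmp.trans hpk)]
      ring
    unfold quantCoeff symbCoeff
    rw [hc, ← hβd, ← hb, ← ha, e1, e2, e3]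
    rw [e2] at hD
    have h12 := left_ne_zero_of_mul hD
    have h3 := right_ne_zero_of_mul hD
    have h1 := left_ne_zero_of_mul h12
    have h2 := right_ne_zero_of_mul h12
    have f1 : (m.factorial : ℝ) ≠ 0 := by positivity
    have f2 : ((p - m).factorial : ℝ) ≠ 0 := by positivity
    have f3 : (p.choose m : ℝ) ≠ 0 := by
      exact_mod_cast (Nat.choose_pos hmp).ne'
    generalize (p.choose m : ℝ) = x1 at *
    generalize (m.factorial : ℝ) = x2 at *
    generalize ((p - m).factorial : ℝ) = x3 at *
    generalize poch b (p - m) = x4 at *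
    generalize poch (b + p - m) (p - 1) = x5 at *
    generalize poch (2 * ((k : ℝ) - m) + β + m - 1) m = x6 at *
    field_simp
  rw [Finset.sum_congr rfl key, ← Finset.mul_sum, diff_sum_zero (b + p) p hp, mul_zero]
end

section
/- Let n ≥ 1 and let δ be a real number. Define H_δ : ℝⁿ × ℝⁿ → ℝ by H_δ(x,ξ) = (1+‖x‖²)^{1−(n+1)δ/2} · (‖ξ‖² + ⟨x,ξ⟩²). Then at every point (x,ξ) ∈ ℝⁿ × ℝⁿ with x in the chart domain, Σ_{i=1}^{n} ∂²H_δ/∂x^i∂ξ^i = 2((n+3) − (n+1)δ) · (1+‖x‖²)^{1−(n+1)δ/2} · ⟨x,ξ⟩. -/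
open Function

/-- The divergence operator `D = Σ_i ∂²/∂x^i∂ξ^i` (formula (2.3)) acting on a
symbol `f(x,ξ)` on `T*ℝⁿ`. -/
noncomputable def divOp (n : ℕ) (f : (Fin n → ℝ) → (Fin n → ℝ) → ℝ)
    (x ξ : Fin n → ℝ) : ℝ :=
  ∑ i : Fin n,
    deriv (fun t : ℝ =>
      deriv (fun s : ℝ => f (Function.update x i t) (Function.update ξ i s)) (ξ i)) (x i)

/-- The weighted geodesic Hamiltonian `H_δ = H √(g^δ)` of degree `δ` in an
affine chart on `Sⁿ`, where `det(g_{ij}) = (1+‖x‖²)^{-(n+1)}`: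
`H_δ(x,ξ) = (1+‖x‖²)^{1-(n+1)δ/2} (‖ξ‖² + ⟨x,ξ⟩²)`. -/
noncomputable def geoHamDelta (n : ℕ) (δ : ℝ) (x ξ : Fin n → ℝ) : ℝ :=
  (1 + ∑ i : Fin n, (x i) ^ 2) ^ (1 - ((n : ℝ) + 1) * δ / 2) *
    ((∑ i : Fin n, (ξ i) ^ 2) + (∑ i : Fin n, x i * ξ i) ^ 2)

theorem sum_update_aux (n : ℕ) (F : Fin n → ℝ → ℝ → ℝ) (x ξ : Fin n → ℝ) (i : Fin n) (t s : ℝ) :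
    ∑ j, F j (Function.update x i t j) (Function.update ξ i s j)
      = F i t s + (∑ j, F j (x j) (ξ j) - F i (x i) (ξ i)) := by
  rw [← Finset.add_sum_erase _ _ (Finset.mem_univ i),
    ← Finset.add_sum_erase _ (fun j => F j (x j) (ξ j)) (Finset.mem_univ i)]
  have : ∑ j ∈ Finset.univ.erase i, F j (Function.update x i t j) (Function.update ξ i s j)
      = ∑ j ∈ Finset.univ.erase i, F j (x j) (ξ j) := by
    apply Finset.sum_congr rfl
    intro j hj
    have hji : j ≠ i := Finset.ne_of_mem_erase hj
    simp [Function.update_of_ne hji]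
  rw [this]
  simp

theorem deriv_term_aux (n : ℕ) (δ : ℝ) (x ξ : Fin n → ℝ) (i : Fin n) (a A P : ℝ)
    (ha : a = 1 - ((n : ℝ) + 1) * δ / 2) (hA : A = 1 + ∑ i : Fin n, (x i) ^ 2)
    (hP : P = ∑ i : Fin n, x i * ξ i) :
    deriv (fun t : ℝ =>
      deriv (fun s : ℝ => geoHamDelta n δ (Function.update x i t) (Function.update ξ i s))
        (ξ i)) (x i)
      = a * A ^ (a - 1) * (2 * x i) * (2 * ξ i + 2 * P * x i)
        + A ^ a * (2 * (x i * ξ i) + 2 * P) := by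
  have hApos : 0 < A := by rw [hA]; positivity
  have h1 : ∀ t s : ℝ, geoHamDelta n δ (Function.update x i t) (Function.update ξ i s)
      = (A + (t ^ 2 - x i ^ 2)) ^ a *
        ((s ^ 2 + (∑ j, (ξ j) ^ 2 - ξ i ^ 2)) + (t * s + (P - x i * ξ i)) ^ 2) := by
    intro t s
    unfold geoHamDelta
    rw [sum_update_aux n (fun _ u _ => u ^ 2) x ξ i t s,
      sum_update_aux n (fun _ _ v => v ^ 2) x ξ i t s,
      sum_update_aux n (fun _ u v => u * v) x ξ i t s, ← ha, ← hP, hA]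
    congr 2
    ring
  have h2 : ∀ t : ℝ, deriv (fun s : ℝ =>
      geoHamDelta n δ (Function.update x i t) (Function.update ξ i s)) (ξ i)
      = (A + (t ^ 2 - x i ^ 2)) ^ a * (2 * ξ i + 2 * (t * ξ i + (P - x i * ξ i)) * t) := by
    intro t
    simp only [h1]
    have e1 := ((hasDerivAt_id (ξ i)).pow 2).add_const (∑ j, (ξ j) ^ 2 - ξ i ^ 2)
    have e2 := (((hasDerivAt_id (ξ i)).const_mul t).add_const (P - x i * ξ i)).pow 2
    have e3 := (e1.add e2).const_mul ((A + (t ^ 2 - x i ^ 2)) ^ a)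
    refine (e3.congr_deriv ?_).deriv
    simp
  simp only [h2]
  have e1 := (((hasDerivAt_id (x i)).pow 2).sub_const (x i ^ 2)).const_add A
  have e2 := e1.rpow_const (p := a) (Or.inl (by simpa using hApos.ne'))
  have e3 := (((((hasDerivAt_id (x i)).mul_const (ξ i)).add_const (P - x i * ξ i)).const_mul
    2).mul (hasDerivAt_id (x i))).const_add (2 * ξ i)
  refine ((e2.mul e3).congr_deriv ?_).deriv
  simp
  ring

/-- First-order divergence computation in the proof of Proposition 4.1:
`D(H_δ) = 2((n+3)-(n+1)δ) (1+‖x‖²)^{1-(n+1)δ/2} ⟨x,ξ⟩`. -/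
theorem div_geoHamDelta
    (n : ℕ) (hn : 1 ≤ n) (δ : ℝ) (x ξ : Fin n → ℝ) :
    divOp n (geoHamDelta n δ) x ξ =
      2 * (((n : ℝ) + 3) - ((n : ℝ) + 1) * δ) *
        (1 + ∑ i : Fin n, (x i) ^ 2) ^ (1 - ((n : ℝ) + 1) * δ / 2) *
        (∑ i : Fin n, x i * ξ i) := by
  have hApos : 0 < 1 + ∑ i : Fin n, (x i) ^ 2 := by positivity
  unfold divOp
  rw [Finset.sum_congr rfl (fun i _ => deriv_term_aux n δ x ξ i _ _ _ rfl rfl rfl)]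
  obtain ⟨a, ha⟩ : ∃ a : ℝ, a = 1 - ((n : ℝ) + 1) * δ / 2 := ⟨_, rfl⟩
  obtain ⟨A, hA⟩ : ∃ A : ℝ, A = 1 + ∑ i : Fin n, (x i) ^ 2 := ⟨_, rfl⟩
  obtain ⟨P, hP⟩ : ∃ P : ℝ, P = ∑ i : Fin n, x i * ξ i := ⟨_, rfl⟩
  rw [← hA] at hApos
  simp only [← ha, ← hA, ← hP]
  have hpow : A ^ a = A ^ (a - 1) * A := by
    rw [Real.rpow_sub_one hApos.ne']
    field_simp
  have hterm : ∀ i : Fin n, a * A ^ (a - 1) * (2 * x i) * (2 * ξ i + 2 * P * x i)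
        + A ^ a * (2 * (x i * ξ i) + 2 * P)
      = (4 * a * A ^ (a - 1) + 2 * A ^ a) * (x i * ξ i)
        + (4 * a * A ^ (a - 1) * P) * (x i ^ 2) + A ^ a * 2 * P := by
    intro i; ring
  simp only [hterm]
  rw [Finset.sum_add_distrib, Finset.sum_add_distrib, ← Finset.mul_sum, ← Finset.mul_sum, ← hP]
  have hS : ∑ i : Fin n, (x i) ^ 2 = A - 1 := by rw [hA]; ring
  rw [hS, hpow]
  simp
  have hd : ((n : ℝ) + 1) * δ = 2 - 2 * a := by rw [ha]; ring
  rw [hd]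
  ring
end
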